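/- arXiv:1107.1720 — 2 statements merged into one kernel-verified Lean document; each statement's English description precedes it below -/
import Mathlib

section
/- Let Z be a curve in ℝ^d, let 0 = t_0 < t_1 < … < t_k = 1, and let S be the polygonal curve with vertices Z(t_0), Z(t_1), …, Z(t_k). For points p, q ∈ ℝ^d, define Δ = d_F(pq, S) + max over 1 ≤ i ≤ k of d_F(Z[t_{i−1}, t_i], segment from Z(t_{i−1}) to Z(t_i)). Then d_F(pq, Z) ≤ Δ ≤ 3·d_F(pq, Z). In particular, Δ is a 3-approximation to the Fréchet distance between the segment pq and the curve Z. -/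
open Set

noncomputable section

namespace Jaywalk

variable {d : ℕ}

/-- An orientation-preserving reparameterization of `[0,1]`: a continuous, strictly
increasing bijection of `[0,1]` onto itself with `f 0 = 0` and `f 1 = 1`. -/
structure IsReparam (f : ℝ → ℝ) : Prop where
  contOn : ContinuousOn f (Icc 0 1)
  strictMonoOn : StrictMonoOn f (Icc 0 1)
  mapsTo : MapsTo f (Icc 0 1) (Icc 0 1)
  surjOn : SurjOn f (Icc 0 1) (Icc 0 1)
  map_zero : f 0 = 0
  map_one : f 1 = 1

/-- The width of a reparameterization `f` with respect to curves `X Y : [0,1] → ℝ^d`. -/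
def frechetWidth (X Y : ℝ → EuclideanSpace ℝ (Fin d)) (f : ℝ → ℝ) : ℝ :=
  ⨆ t : Icc (0:ℝ) 1, ‖X (f ↑t) - Y ↑t‖

/-- The Fréchet distance between two curves `X Y : [0,1] → ℝ^d`. -/
def frechetDist (X Y : ℝ → EuclideanSpace ℝ (Fin d)) : ℝ :=
  sInf {w | ∃ f, IsReparam f ∧ w = frechetWidth X Y f}

/-- The segment from `p` to `q`, as a curve `t ↦ (1-t)·p + t·q`. -/
def seg (p q : EuclideanSpace ℝ (Fin d)) : ℝ → EuclideanSpace ℝ (Fin d) :=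
  fun t => (1 - t) • p + t • q

/-- The subcurve `Z[s,t]`, affinely reparameterized over `[0,1]`. -/
def subcurve (Z : ℝ → EuclideanSpace ℝ (Fin d)) (s t : ℝ) : ℝ → EuclideanSpace ℝ (Fin d) :=
  fun τ => Z (s + τ * (t - s))

/-- Vertices extended to all of `ℕ` (clamped at `n`). -/
def vtx {n : ℕ} (v : Fin (n+1) → EuclideanSpace ℝ (Fin d)) (i : ℕ) :
    EuclideanSpace ℝ (Fin d) :=
  v ⟨min i n, Nat.lt_succ_of_le (min_le_right i n)⟩

/-- The uniformly parameterized polygonal curve through the vertices `v 0, …, v n`. -/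
def polyCurve {n : ℕ} (v : Fin (n+1) → EuclideanSpace ℝ (Fin d)) :
    ℝ → EuclideanSpace ℝ (Fin d) :=
  fun t =>
    (1 - (t * n - ⌊t * n⌋₊)) • vtx v ⌊t * n⌋₊ + (t * n - ⌊t * n⌋₊) • vtx v (⌊t * n⌋₊ + 1)

/-- Concatenation of two curves (sharing an endpoint). -/
def concat (A B : ℝ → EuclideanSpace ℝ (Fin d)) : ℝ → EuclideanSpace ℝ (Fin d) :=
  fun t => if t ≤ 1/2 then A (2 * t) else B (2 * t - 1)

/-- Concatenation of a finite list of curves. -/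
def concatList : List (ℝ → EuclideanSpace ℝ (Fin d)) → ℝ → EuclideanSpace ℝ (Fin d)
  | [] => fun _ => 0
  | [A] => A
  | A :: B :: rest => concat A (concatList (B :: rest))

/-- Given curves `X Y`, the price of the tunnel from `a` to `b` (points of `[0,1]²`):
the Fréchet distance between the subcurve `X[a.1, b.1]` and the segment from
`Y a.2` to `Y b.2`. -/
def tunnelPrice (X Y : ℝ → EuclideanSpace ℝ (Fin d)) (a b : ℝ × ℝ) : ℝ :=
  frechetDist (subcurve X a.1 b.1) (seg (Y a.2) (Y b.2))

open Classical in
/-- Indices of marked vertices in the greedy `μ`-simplification of the polygonal curve with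
vertices `v 0, …, v n`:  start at vertex `0`; repeatedly jump to the first later vertex at
distance at least `μ` from the current one; finally also mark the last vertex `n`
(the sequence stabilizes at `n`). -/
def simplIdx (v : ℕ → EuclideanSpace ℝ (Fin d)) (μ : ℝ) (n : ℕ) : ℕ → ℕ
  | 0 => 0
  | k+1 =>
    if h : ∃ j, simplIdx v μ n k < j ∧ j ≤ n ∧ μ ≤ ‖v j - v (simplIdx v μ n k)‖
    then Nat.find h
    else n

/-- The vertices of the `μ`-simplification (with the final vertex repeated). -/
def simplVerts {n : ℕ} (v : Fin (n+1) → EuclideanSpace ℝ (Fin d)) (μ : ℝ) :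
    Fin (n+1) → EuclideanSpace ℝ (Fin d) :=
  fun k => vtx v (simplIdx (vtx v) μ n k.val)

/-- The `μ`-simplification `simpl(X, μ)` of the polygonal curve with vertices
`v 0, …, v n`: the polygonal curve through the marked vertices, in order. -/
def simpl {n : ℕ} (v : Fin (n+1) → EuclideanSpace ℝ (Fin d)) (μ : ℝ) :
    ℝ → EuclideanSpace ℝ (Fin d) :=
  polyCurve (simplVerts v μ)

/-- `y` is the parameter of a vertex of a (uniformly parameterized) polygonal curve
with `n` edges. -/
def vertexParam (n : ℕ) (y : ℝ) : Prop := ∃ i : Fin (n+1), y = ((i : ℕ) : ℝ) / n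

/-- The shortcut curve of `Y` determined by the list of shortcut parameter pairs,
starting from parameter `a`. -/
def shortcutFrom (Y : ℝ → EuclideanSpace ℝ (Fin d)) :
    List (ℝ × ℝ) → ℝ → ℝ → EuclideanSpace ℝ (Fin d)
  | [], a => subcurve Y a 1
  | (y₁, y₂) :: rest, a =>
      concat (subcurve Y a y₁) (concat (seg (Y y₁) (Y y₂)) (shortcutFrom Y rest y₂))

/-- The shortcut parameter pairs form a nondecreasing sequence inside `[0,1]` and all
parameters are vertices of the polygonal curve with `n` edges. -/
def ValidShortcuts (n : ℕ) (L : List (ℝ × ℝ)) : Prop :=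
  List.Chain' (· ≤ ·) ((0:ℝ) :: (L.flatMap fun p => [p.1, p.2]) ++ [1]) ∧
  ∀ p ∈ L, vertexParam n p.1 ∧ vertexParam n p.2

/-- The directed vertex-restricted `k`-shortcut Fréchet distance between a curve `X` and the
polygonal curve with vertices `w 0, …, w n`: the infimum of the Fréchet distance between `X`
and any vertex-restricted shortcut curve of `polyCurve w` with at most `k` shortcuts. -/
def shortcutFrechetDist {n : ℕ} (X : ℝ → EuclideanSpace ℝ (Fin d))
    (w : Fin (n+1) → EuclideanSpace ℝ (Fin d)) (k : ℕ) : ℝ :=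
  sInf {r | ∃ L : List (ℝ × ℝ), L.length ≤ k ∧ ValidShortcuts n L ∧
    r = frechetDist X (shortcutFrom (polyCurve w) L 0)}

/-- The directed vertex-restricted shortcut Fréchet distance (unbounded number of
shortcuts). -/
def shortcutFrechetDistUnbounded {n : ℕ} (X : ℝ → EuclideanSpace ℝ (Fin d))
    (w : Fin (n+1) → EuclideanSpace ℝ (Fin d)) : ℝ :=
  sInf {r | ∃ L : List (ℝ × ℝ), ValidShortcuts n L ∧
    r = frechetDist X (shortcutFrom (polyCurve w) L 0)}

/-- `f` restricts to a strictly increasing bijection of `[a,b]` onto `[a',b']`. -/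
structure IsMonoBij (f : ℝ → ℝ) (a b a' b' : ℝ) : Prop where
  strictMonoOn : StrictMonoOn f (Icc a b)
  image_eq : f '' Icc a b = Icc a' b'

namespace IsMonoBij

variable {f g : ℝ → ℝ} {a b c a' b' c' a'' b'' : ℝ}

theorem mem (hf : IsMonoBij f a b a' b') {x : ℝ} (hx : x ∈ Icc a b) : f x ∈ Icc a' b' :=
  hf.image_eq ▸ mem_image_of_mem f hx

theorem exists_eq (hf : IsMonoBij f a b a' b') {y : ℝ} (hy : y ∈ Icc a' b') :
    ∃ x ∈ Icc a b, f x = y := by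
  rw [← hf.image_eq] at hy
  exact hy

theorem left_le_right (hf : IsMonoBij f a b a' b') (hab : a ≤ b) : a' ≤ b' :=
  nonempty_Icc.1 ⟨f a, hf.mem (left_mem_Icc.2 hab)⟩

theorem map_left (hf : IsMonoBij f a b a' b') (hab : a ≤ b) : f a = a' := by
  obtain ⟨x, hx, hxe⟩ := hf.exists_eq (left_mem_Icc.2 (hf.left_le_right hab))
  have h := hf.strictMonoOn.monotoneOn (left_mem_Icc.2 hab) hx hx.1
  exact le_antisymm (hxe ▸ h) (hf.mem (left_mem_Icc.2 hab)).1

theorem map_right (hf : IsMonoBij f a b a' b') (hab : a ≤ b) : f b = b' := by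
  obtain ⟨x, hx, hxe⟩ := hf.exists_eq (right_mem_Icc.2 (hf.left_le_right hab))
  have h := hf.strictMonoOn.monotoneOn hx (right_mem_Icc.2 hab) hx.2
  exact le_antisymm (hf.mem (right_mem_Icc.2 hab)).2 (hxe ▸ h)

protected theorem id : IsMonoBij id a b a b :=
  ⟨strictMono_id.strictMonoOn _, image_id _⟩

theorem comp (hg : IsMonoBij g a' b' a'' b'') (hf : IsMonoBij f a b a' b') :
    IsMonoBij (g ∘ f) a b a'' b'' :=
  ⟨hg.strictMonoOn.comp hf.strictMonoOn fun _ hx => hf.mem hx, by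
    rw [image_comp, hf.image_eq, hg.image_eq]⟩

theorem exists_inverse (hf : IsMonoBij f a b a' b') :
    ∃ g, IsMonoBij g a' b' a b ∧ (∀ x ∈ Icc a b, g (f x) = x) ∧
      ∀ y ∈ Icc a' b', f (g y) = y := by
  have hbij : BijOn f (Icc a b) (Icc a' b') :=
    ⟨fun _ hx => hf.mem hx, hf.strictMonoOn.injOn, hf.image_eq.ge⟩
  have hinv := hbij.invOn_invFunOn
  have hbij' := BijOn.symm hinv.symm hbij
  refine ⟨Function.invFunOn f (Icc a b), ⟨?_, hbij'.image_eq⟩, hinv.1, hinv.2⟩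
  intro x hx y hy hxy
  rw [← hf.strictMonoOn.lt_iff_lt (hbij'.mapsTo hx) (hbij'.mapsTo hy), hinv.2 hx, hinv.2 hy]
  exact hxy

theorem restrict (hf : IsMonoBij f a b a' b') {s t : ℝ} (hs : s ∈ Icc a b) (ht : t ∈ Icc a b) :
    IsMonoBij f s t (f s) (f t) := by
  have hsub : Icc s t ⊆ Icc a b := Icc_subset_Icc hs.1 ht.2
  refine ⟨hf.strictMonoOn.mono hsub, Subset.antisymm ?_ ?_⟩
  · rintro _ ⟨x, hx, rfl⟩
    exact ⟨hf.strictMonoOn.monotoneOn hs (hsub hx) hx.1,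
      hf.strictMonoOn.monotoneOn (hsub hx) ht hx.2⟩
  · intro y hy
    obtain ⟨x, hx, rfl⟩ := hf.exists_eq
      (⟨(hf.mem hs).1.trans hy.1, hy.2.trans (hf.mem ht).2⟩ : y ∈ Icc a' b')
    exact ⟨x, ⟨(hf.strictMonoOn.le_iff_le hs hx).1 hy.1,
      (hf.strictMonoOn.le_iff_le hx ht).1 hy.2⟩, rfl⟩

theorem affine (hab : a < b) : IsMonoBij (fun τ => a + τ * (b - a)) 0 1 a b := by
  have hpos : 0 < b - a := sub_pos.2 hab
  refine ⟨fun x _ y _ hxy => ?_, Subset.antisymm ?_ ?_⟩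
  · have := mul_lt_mul_of_pos_right hxy hpos
    simpa using this
  · rintro _ ⟨x, hx, rfl⟩
    constructor <;> nlinarith [hx.1, hx.2]
  · intro y hy
    refine ⟨(y - a) / (b - a), ⟨div_nonneg (sub_nonneg.2 hy.1) hpos.le,
      (div_le_one hpos).2 (by linarith [hy.2])⟩, ?_⟩
    simp only
    field_simp
    ring

theorem congr (hf : IsMonoBij f a b a' b') (h : EqOn f g (Icc a b)) : IsMonoBij g a b a' b' :=
  ⟨hf.strictMonoOn.congr h, by rw [← h.image_eq, hf.image_eq]⟩

theorem union (hf : IsMonoBij f a b a' b') (hg : IsMonoBij f b c b' c') (hab : a ≤ b)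
    (hbc : b ≤ c) : IsMonoBij f a c a' c' := by
  refine ⟨?_, ?_⟩
  · rw [← Icc_union_Icc_eq_Icc hab hbc]
    exact hf.strictMonoOn.union hg.strictMonoOn (isGreatest_Icc hab) (isLeast_Icc hbc)
  · rw [← Icc_union_Icc_eq_Icc hab hbc, image_union, hf.image_eq, hg.image_eq,
      Icc_union_Icc_eq_Icc (hf.left_le_right hab) (hg.left_le_right hbc)]

theorem isReparam (hf : IsMonoBij f 0 1 0 1) : IsReparam f where
  contOn := by
    let F : Icc (0:ℝ) 1 → Icc (0:ℝ) 1 := fun x => ⟨f x, hf.mem x.2⟩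
    have hmono : StrictMono F := fun x y hxy => hf.strictMonoOn x.2 y.2 hxy
    have hsurj : Function.Surjective F := fun y => by
      obtain ⟨x, hx, hxy⟩ := hf.exists_eq y.2
      exact ⟨⟨x, hx⟩, Subtype.ext hxy⟩
    have hcont : Continuous F := (hmono.orderIsoOfSurjective F hsurj).continuous
    exact continuousOn_iff_continuous_domRestrict.2 (continuous_subtype_val.comp hcont)
  strictMonoOn := hf.strictMonoOn
  mapsTo := fun _ hx => hf.mem hx
  surjOn := hf.image_eq.ge
  map_zero := hf.map_left zero_le_one
  map_one := hf.map_right zero_le_one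

end IsMonoBij

theorem IsReparam.isMonoBij {f : ℝ → ℝ} (hf : IsReparam f) : IsMonoBij f 0 1 0 1 :=
  ⟨hf.strictMonoOn, Subset.antisymm hf.mapsTo.image_subset hf.surjOn⟩

/-- The pieces `X[a',b']` and `Y[a,b]` can be traversed monotonically while staying within
distance `w` of each other. -/
def Matched (X Y : ℝ → EuclideanSpace ℝ (Fin d)) (a b a' b' w : ℝ) : Prop :=
  ∃ f, IsMonoBij f a b a' b' ∧ ∀ t ∈ Icc a b, ‖X (f t) - Y t‖ ≤ w

namespace Matched

variable {X Y W : ℝ → EuclideanSpace ℝ (Fin d)} {a b c a' b' c' a'' b'' w w' : ℝ}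

theorem symm (h : Matched X Y a b a' b' w) : Matched Y X a' b' a b w := by
  obtain ⟨f, hf, hw⟩ := h
  obtain ⟨g, hg, -, hfg⟩ := hf.exists_inverse
  refine ⟨g, hg, fun t ht => ?_⟩
  have := hw (g t) (hg.mem ht)
  rwa [hfg t ht, norm_sub_rev] at this

theorem trans (h : Matched X Y a' b' a'' b'' w) (h' : Matched Y W a b a' b' w') :
    Matched X W a b a'' b'' (w + w') := by
  obtain ⟨f, hf, hw⟩ := h
  obtain ⟨g, hg, hw'⟩ := h'
  refine ⟨f ∘ g, hf.comp hg, fun t ht => ?_⟩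
  exact (norm_sub_le_norm_sub_add_norm_sub _ (Y (g t)) _).trans
    (add_le_add (hw _ (hg.mem ht)) (hw' t ht))

theorem union (h : Matched X Y a b a' b' w) (h' : Matched X Y b c b' c' w) (hab : a ≤ b)
    (hbc : b ≤ c) : Matched X Y a c a' c' w := by
  obtain ⟨f, hf, hw⟩ := h
  obtain ⟨g, hg, hw'⟩ := h'
  let k : ℝ → ℝ := fun t => if t ≤ b then f t else g t
  have hkf : EqOn f k (Icc a b) := fun t ht => (if_pos ht.2).symm
  have hkg : EqOn g k (Icc b c) := fun t ht => by
    rcases ht.1.eq_or_lt with rfl | hlt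
    · simp [k, hf.map_right hab, hg.map_left hbc]
    · exact (if_neg hlt.not_ge).symm
  refine ⟨k, (hf.congr hkf).union (hg.congr hkg) hab hbc, fun t ht => ?_⟩
  rcases le_total t b with htb | htb
  · rw [← hkf ⟨ht.1, htb⟩]
    exact hw t ⟨ht.1, htb⟩
  · rw [← hkg ⟨htb, ht.2⟩]
    exact hw' t ⟨htb, ht.2⟩

theorem of_forall_succ {s s' : ℕ → ℝ} {n : ℕ} (hn : 1 ≤ n) (hs : ∀ i < n, s i ≤ s (i + 1))
    (h : ∀ i < n, Matched X Y (s i) (s (i + 1)) (s' i) (s' (i + 1)) w) :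
    Matched X Y (s 0) (s n) (s' 0) (s' n) w := by
  induction n, hn using Nat.le_induction with
  | base => exact h 0 zero_lt_one
  | succ n hn ih =>
    refine (ih (fun i hi => hs i (by lia)) fun i hi => h i (by lia)).union (h n (by lia)) ?_
      (hs n (by lia))
    have : ∀ j ≤ n, s 0 ≤ s j := fun j => by
      induction j with
      | zero => exact fun _ => le_rfl
      | succ j ihj => exact fun hj => (ihj (by lia)).trans (hs j (by lia))
    exact this n le_rfl

theorem subcurve_iff (hab : a < b) (hab' : a' < b') :
    Matched (subcurve X a' b') (subcurve Y a b) 0 1 0 1 w ↔ Matched X Y a b a' b' w := by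
  have hα := IsMonoBij.affine hab'
  have hβ := IsMonoBij.affine hab
  constructor
  · rintro ⟨f, hf, hw⟩
    obtain ⟨g, hg, -, hβg⟩ := hβ.exists_inverse
    refine ⟨_, hα.comp (hf.comp hg), fun t ht => ?_⟩
    have := hw (g t) (hg.mem ht)
    simp only [subcurve] at this
    rwa [hβg t ht] at this
  · rintro ⟨f, hf, hw⟩
    obtain ⟨g, hg, -, hαg⟩ := hα.exists_inverse
    refine ⟨_, hg.comp (hf.comp hβ), fun t ht => ?_⟩
    have := hw _ (hβ.mem ht)
    simp only [subcurve, Function.comp_apply]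
    rwa [hαg _ (hf.mem (hβ.mem ht))]

theorem frechetDist_le (h : Matched X Y 0 1 0 1 w) : frechetDist X Y ≤ w := by
  obtain ⟨f, hf, hw⟩ := h
  have hbdd : BddBelow {w | ∃ f, IsReparam f ∧ w = frechetWidth X Y f} := by
    refine ⟨0, ?_⟩
    rintro _ ⟨g, -, rfl⟩
    exact Real.iSup_nonneg fun _ => norm_nonneg _
  exact (csInf_le hbdd ⟨f, hf.isReparam, rfl⟩).trans (ciSup_le fun t => hw t t.2)

theorem of_frechetDist_lt {C C' : ℝ} (hX : ∀ t ∈ Icc (0:ℝ) 1, ‖X t‖ ≤ C)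
    (hY : ∀ t ∈ Icc (0:ℝ) 1, ‖Y t‖ ≤ C') (h : frechetDist X Y < w) :
    Matched X Y 0 1 0 1 w := by
  obtain ⟨_, ⟨f, hf, rfl⟩, hlt⟩ :=
    exists_lt_of_csInf_lt (s := {w | ∃ f, IsReparam f ∧ w = frechetWidth X Y f})
      ⟨_, id, IsMonoBij.id.isReparam, rfl⟩ h
  refine ⟨f, hf.isMonoBij, fun t ht => le_trans ?_ hlt.le⟩
  have hbdd : BddAbove (range fun t : Icc (0:ℝ) 1 => ‖X (f t) - Y t‖) := by
    refine ⟨C + C', ?_⟩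
    rintro _ ⟨t, rfl⟩
    exact (norm_sub_le _ _).trans (add_le_add (hX _ (hf.mapsTo t.2)) (hY _ t.2))
  exact le_ciSup hbdd ⟨t, ht⟩

end Matched

variable {p q p' q' : EuclideanSpace ℝ (Fin d)}

theorem norm_seg_sub_seg_le {w : ℝ} (hp : ‖p - p'‖ ≤ w) (hq : ‖q - q'‖ ≤ w) {t : ℝ}
    (ht : t ∈ Icc (0:ℝ) 1) : ‖seg p q t - seg p' q' t‖ ≤ w := by
  have h : seg p q t - seg p' q' t = (1 - t) • (p - p') + t • (q - q') := by
    simp only [seg]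
    module
  have h1 : 0 ≤ 1 - t := sub_nonneg.2 ht.2
  calc ‖seg p q t - seg p' q' t‖ ≤ ‖(1 - t) • (p - p')‖ + ‖t • (q - q')‖ := h ▸ norm_add_le _ _
    _ = (1 - t) * ‖p - p'‖ + t * ‖q - q'‖ := by
      rw [norm_smul_of_nonneg h1, norm_smul_of_nonneg ht.1]
    _ ≤ (1 - t) * w + t * w := by
      have := ht.1
      gcongr
    _ = w := by ring

theorem matched_seg {w : ℝ} (hp : ‖p - p'‖ ≤ w) (hq : ‖q - q'‖ ≤ w) :
    Matched (seg p q) (seg p' q') 0 1 0 1 w :=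
  ⟨id, IsMonoBij.id, fun _ ht => norm_seg_sub_seg_le hp hq ht⟩

theorem norm_seg_le {t : ℝ} (ht : t ∈ Icc (0:ℝ) 1) {C : ℝ} (hp : ‖p‖ ≤ C) (hq : ‖q‖ ≤ C) :
    ‖seg p q t‖ ≤ C := by
  have := norm_seg_sub_seg_le (p' := 0) (q' := 0) (by simpa using hp) (by simpa using hq) ht
  simpa [seg] using this

theorem subcurve_seg (p q : EuclideanSpace ℝ (Fin d)) (a b : ℝ) :
    subcurve (seg p q) a b = seg (seg p q a) (seg p q b) := by
  funext τ
  simp only [subcurve, seg]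
  module

theorem polyCurve_eq_seg {n : ℕ} (v : Fin (n+1) → EuclideanSpace ℝ (Fin d)) (t : ℝ) :
    polyCurve v t = seg (vtx v ⌊t * n⌋₊) (vtx v (⌊t * n⌋₊ + 1)) (t * n - ⌊t * n⌋₊) :=
  rfl

theorem norm_polyCurve_le {n : ℕ} {v : Fin (n+1) → EuclideanSpace ℝ (Fin d)} {C : ℝ}
    (hv : ∀ i, ‖v i‖ ≤ C) {t : ℝ} (ht : 0 ≤ t) : ‖polyCurve v t‖ ≤ C := by
  rw [polyCurve_eq_seg]
  have h0 : 0 ≤ t * n := by positivity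
  exact norm_seg_le ⟨sub_nonneg.2 (Nat.floor_le h0), by linarith [Nat.lt_floor_add_one (t * n)]⟩
    (hv _) (hv _)

theorem subcurve_polyCurve {n : ℕ} (hn : 1 ≤ n) (v : Fin (n+1) → EuclideanSpace ℝ (Fin d)) (i : ℕ)
    {τ : ℝ} (hτ : τ ∈ Icc (0:ℝ) 1) :
    subcurve (polyCurve v) (i / n) ((i + 1 : ℕ) / n) τ = seg (vtx v i) (vtx v (i + 1)) τ := by
  have hn0 : (n : ℝ) ≠ 0 := by positivity
  have harg : ((i : ℝ) / n + τ * (((i + 1 : ℕ) : ℝ) / n - i / n)) * n = i + τ := by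
    push_cast
    field_simp
    ring
  rw [subcurve, polyCurve_eq_seg, harg]
  rcases hτ.2.eq_or_lt with rfl | hlt
  · have hfl : ⌊(i : ℝ) + 1⌋₊ = i + 1 := by exact_mod_cast Nat.floor_natCast (R := ℝ) (i + 1)
    rw [hfl]
    simp [seg]
  · have hfl : ⌊(i : ℝ) + τ⌋₊ = i := by
      rw [Nat.floor_eq_iff (add_nonneg (Nat.cast_nonneg i) hτ.1)]
      exact ⟨by linarith [hτ.1], by linarith⟩
    rw [hfl, add_sub_cancel_left]

theorem Matched.subcurve_polyCurve_right {n : ℕ} (hn : 1 ≤ n)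
    {v : Fin (n+1) → EuclideanSpace ℝ (Fin d)} {X : ℝ → EuclideanSpace ℝ (Fin d)} {i : ℕ}
    {a b w : ℝ} (hab : a < b)
    (h : Matched (subcurve X a b) (seg (vtx v i) (vtx v (i + 1))) 0 1 0 1 w) :
    Matched X (polyCurve v) (i / n) ((i + 1 : ℕ) / n) a b w := by
  have hn0 : (0 : ℝ) < n := by positivity
  have hlt : (i : ℝ) / n < (i + 1 : ℕ) / n := by
    gcongr
    exact i.lt_succ_self
  obtain ⟨f, hf, hw⟩ := h
  refine (Matched.subcurve_iff hlt hab).1 ⟨f, hf, fun t ht => ?_⟩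
  rw [subcurve_polyCurve hn v i ht]
  exact hw t ht

theorem Matched.polyCurve_right {n : ℕ} (hn : 1 ≤ n)
    {v : Fin (n+1) → EuclideanSpace ℝ (Fin d)} {X : ℝ → EuclideanSpace ℝ (Fin d)} {s : ℕ → ℝ}
    {w : ℝ} (hs : ∀ i < n, s i < s (i + 1)) (h0 : s 0 = 0) (h1 : s n = 1)
    (h : ∀ i < n,
      Matched (subcurve X (s i) (s (i + 1))) (seg (vtx v i) (vtx v (i + 1))) 0 1 0 1 w) :
    Matched X (polyCurve v) 0 1 0 1 w := by
  have hn0 : (n : ℝ) ≠ 0 := by positivity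
  have := Matched.of_forall_succ (s := fun i : ℕ => (i : ℝ) / n) (s' := s) hn
    (fun i _ => by gcongr; exact i.le_succ)
    fun i hi => (h i hi).subcurve_polyCurve_right hn (hs i hi)
  simpa [h0, h1, div_self hn0] using this

/-- For a segment `pq` and a curve `Z` broken at parameters
`0 = t 0 < … < t m = 1` with spine curve `S`, the quantity
`Δ = d_F(pq, S) + max_i d_F(Z[t (i-1), t i], seg)` is a `3`-approximation to
`d_F(pq, Z)`:  `d_F(pq, Z) ≤ Δ ≤ 3 d_F(pq, Z)`. -/
theorem frechetDist_seg_approx {d m : ℕ} (hm : 1 ≤ m)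
    (Z : ℝ → EuclideanSpace ℝ (Fin d)) (hZ : ContinuousOn Z (Icc 0 1))
    (t : Fin (m+1) → ℝ) (hmono : StrictMono t) (h0 : t 0 = 0) (h1 : t (Fin.last m) = 1)
    (p q : EuclideanSpace ℝ (Fin d)) :
    let Δ := frechetDist (seg p q) (polyCurve (fun i => Z (t i))) +
      ⨆ i : Fin m, frechetDist (subcurve Z (t i.castSucc) (t i.succ))
        (seg (Z (t i.castSucc)) (Z (t i.succ)))
    frechetDist (seg p q) Z ≤ Δ ∧ Δ ≤ 3 * frechetDist (seg p q) Z := by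
  intro Δ
  set v : Fin (m+1) → EuclideanSpace ℝ (Fin d) := fun i => Z (t i)
  let T : ℕ → ℝ := fun i => t ⟨min i m, Nat.lt_succ_of_le (min_le_right i m)⟩
  have hT0 : T 0 = 0 := by simpa [T] using h0
  have hT1 : T m = 1 := by simpa [T, Fin.last] using h1
  have hTc : ∀ i : Fin m, t i.castSucc = T i := fun i =>
    congrArg t (Fin.ext (min_eq_left i.2.le).symm)
  have hTs : ∀ i : Fin m, t i.succ = T (i + 1) := fun i =>
    congrArg t (Fin.ext (min_eq_left (Nat.succ_le_of_lt i.2)).symm)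
  have hTlt : ∀ i < m, T i < T (i + 1) := fun i hi => by
    rw [← hTc ⟨i, hi⟩, ← hTs ⟨i, hi⟩]
    exact hmono Fin.castSucc_lt_succ
  have htmem : ∀ i, t i ∈ Icc (0:ℝ) 1 := fun i =>
    ⟨h0 ▸ hmono.monotone (Fin.zero_le i), h1 ▸ hmono.monotone (Fin.le_last i)⟩
  have hTmem : ∀ i, T i ∈ Icc (0:ℝ) 1 := fun i => htmem _
  have hvT : ∀ i, vtx v i = Z (T i) := fun _ => rfl
  obtain ⟨C, hC⟩ := isCompact_Icc.exists_bound_of_continuousOn hZ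
  have hS : ∀ x ∈ Icc (0:ℝ) 1, ‖polyCurve v x‖ ≤ C := fun x hx =>
    norm_polyCurve_le (fun i => hC _ (htmem i)) hx.1
  have hpq : ∀ x ∈ Icc (0:ℝ) 1, ‖seg p q x‖ ≤ max ‖p‖ ‖q‖ := fun x hx =>
    norm_seg_le hx (le_max_left _ _) (le_max_right _ _)
  constructor
  · refine le_of_forall_pos_le_add fun ε hε => ?_
    have hspine := Matched.of_frechetDist_lt hpq hS (lt_add_of_pos_right _ (half_pos hε))
    set M := ⨆ i : Fin m, frechetDist (subcurve Z (t i.castSucc) (t i.succ))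
        (seg (Z (t i.castSucc)) (Z (t i.succ))) with hM
    have hpieces : Matched Z (polyCurve v) 0 1 0 1 (M + ε / 2) := by
      refine Matched.polyCurve_right hm hTlt hT0 hT1 fun i hi => ?_
      rw [hvT, hvT]
      refine Matched.of_frechetDist_lt
        (fun τ hτ => hC _ ?_)
        (fun τ hτ => norm_seg_le hτ (hC _ (hTmem _)) (hC _ (hTmem _))) ?_
      · exact Icc_subset_Icc (hTmem i).1 (hTmem (i + 1)).2
          ((IsMonoBij.affine (hTlt i hi)).mem hτ)
      · have := le_ciSup (f := fun i : Fin m => frechetDist (subcurve Z (t i.castSucc) (t i.succ))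
          (seg (Z (t i.castSucc)) (Z (t i.succ)))) (finite_range _).bddAbove ⟨i, hi⟩
        simp only [hTc, hTs] at this
        simp only [hM, hTc, hTs]
        linarith
    refine (hspine.trans hpieces.symm).frechetDist_le.trans_eq ?_
    simp only [Δ]
    ring
  · refine le_of_forall_pos_le_add fun ε hε => ?_
    obtain ⟨f, hf, hw⟩ := Matched.of_frechetDist_lt hpq hC
      (lt_add_of_pos_right (frechetDist (seg p q) Z) (by positivity : 0 < ε / 3))
    set w := frechetDist (seg p q) Z + ε / 3
    have hflt : ∀ i < m, f (T i) < f (T (i + 1)) := fun i hi =>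
      hf.strictMonoOn (hTmem i) (hTmem (i + 1)) (hTlt i hi)
    have hseg : ∀ i, Matched (subcurve (seg p q) (f (T i)) (f (T (i + 1))))
        (seg (Z (T i)) (Z (T (i + 1)))) 0 1 0 1 w := fun i => by
      rw [subcurve_seg]
      exact matched_seg (hw _ (hTmem i)) (hw _ (hTmem (i + 1)))
    have hspine : frechetDist (seg p q) (polyCurve v) ≤ w := by
      refine (Matched.polyCurve_right (s := fun i => f (T i)) hm hflt ?_ ?_
        fun i _ => ?_).frechetDist_le
      · simpa only [hT0] using hf.map_left zero_le_one
      · simpa only [hT1] using hf.map_right zero_le_one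
      · rw [hvT, hvT]
        exact hseg i
    have hpieces : ⨆ i : Fin m, frechetDist (subcurve Z (t i.castSucc) (t i.succ))
        (seg (Z (t i.castSucc)) (Z (t i.succ))) ≤ w + w := by
      have : Nonempty (Fin m) := ⟨⟨0, hm⟩⟩
      refine ciSup_le fun i => ?_
      rw [hTc, hTs]
      have hrestrict : Matched (seg p q) Z (T i) (T (i + 1)) (f (T i)) (f (T (i + 1))) w :=
        ⟨f, hf.restrict (hTmem _) (hTmem _), fun x hx =>
          hw x (Icc_subset_Icc (hTmem _).1 (hTmem _).2 hx)⟩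
      have hsub := (Matched.subcurve_iff (hTlt i i.2) (hflt i i.2)).2 hrestrict
      exact (hsub.symm.trans (hseg i)).frechetDist_le
    refine (add_le_add hspine hpieces).trans_eq ?_
    simp only [w]
    ring

end Jaywalk
end
end

section
/- Let Z be a polygonal curve in ℝ^d with n vertices and let k be an integer with k ≥ 2. Then there exists a subset V of the vertices of Z containing both endpoints of Z, with |V| ≤ 2(k−1)+1, such that the spine curve of Z through V satisfies d_F(spinecurve(Z,V), Z) ≤ 11·d_F(Y, Z) for every polygonal curve Y with at most k vertices. -/
open Set

noncomputable section

namespace Jaywalk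

variable {d : ℕ}

lemma frechetWidth_nonneg (X Y : ℝ → EuclideanSpace ℝ (Fin d)) (f : ℝ → ℝ) :
    0 ≤ frechetWidth X Y f :=
  Real.iSup_nonneg fun _ => norm_nonneg _

lemma frechetDist_nonneg (X Y : ℝ → EuclideanSpace ℝ (Fin d)) : 0 ≤ frechetDist X Y := by
  apply Real.sInf_nonneg
  rintro w ⟨f, -, rfl⟩
  exact frechetWidth_nonneg X Y f

lemma frechetDist_le {X Y : ℝ → EuclideanSpace ℝ (Fin d)} {f : ℝ → ℝ} {w : ℝ}
    (hf : IsReparam f) (h : ∀ t ∈ Icc (0 : ℝ) 1, ‖X (f t) - Y t‖ ≤ w) :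
    frechetDist X Y ≤ w := by
  have hle : frechetDist X Y ≤ frechetWidth X Y f := by
    refine csInf_le ⟨0, ?_⟩ ⟨f, hf, rfl⟩
    rintro w ⟨f, -, rfl⟩
    exact frechetWidth_nonneg X Y f
  have : Nonempty (Icc (0 : ℝ) 1) := ⟨⟨0, by simp⟩⟩
  exact hle.trans <| ciSup_le fun t => h t t.2

lemma isReparam_id : IsReparam id where
  contOn := continuousOn_id
  strictMonoOn := strictMono_id.strictMonoOn _
  mapsTo := fun _ h => h
  surjOn := fun x h => ⟨x, h, rfl⟩
  map_zero := rfl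
  map_one := rfl

lemma IsReparam.of_strictMonoOn {f : ℝ → ℝ} (hc : ContinuousOn f (Icc 0 1))
    (hm : StrictMonoOn f (Icc 0 1)) (h0 : f 0 = 0) (h1 : f 1 = 1) : IsReparam f where
  contOn := hc
  strictMonoOn := hm
  mapsTo := fun t ht => by
    have h := hm.monotoneOn
    exact ⟨h0 ▸ h (by simp) ht ht.1, h1 ▸ h ht (by simp) ht.2⟩
  surjOn := by
    have h := intermediate_value_Icc zero_le_one hc
    rwa [h0, h1] at h
  map_zero := h0
  map_one := h1

/-- Reparameterizations of consecutive intervals glue to a reparameterization of `[0,1]`. -/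
lemma exists_isReparam_glue {m : ℕ} (hm : 0 < m) {s : ℕ → ℝ} (hs : Monotone s)
    (hs0 : s 0 = 0) (hsm : s m = 1) {φ : ℕ → ℝ → ℝ}
    (hc : ∀ j < m, ContinuousOn (φ j) (Icc (s j) (s (j + 1))))
    (hφ : ∀ j < m, StrictMonoOn (φ j) (Icc (s j) (s (j + 1))))
    (h0 : ∀ j < m, φ j (s j) = 0) (h1 : ∀ j < m, φ j (s (j + 1)) = 1) :
    ∃ g, IsReparam g ∧
      ∀ j < m, ∀ t ∈ Icc (s j) (s (j + 1)), g t * m = j + φ j t := by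
  have hm' : (0 : ℝ) < m := by exact_mod_cast hm
  let c : ℕ → ℝ → ℝ := fun j t => max (s j) (min t (s (j + 1)))
  have hcm : ∀ j t, c j t ∈ Icc (s j) (s (j + 1)) := fun j t =>
    ⟨le_max_left _ _, max_le (hs j.le_succ) (min_le_right _ _)⟩
  have hcmono : ∀ j, Monotone (c j) := fun j t t' h =>
    max_le_max le_rfl (min_le_min h le_rfl)
  have hceq : ∀ j, ∀ t ∈ Icc (s j) (s (j + 1)), c j t = t := fun j t ht => by
    simp only [c]; rw [min_eq_left ht.2, max_eq_right ht.1]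
  let g : ℝ → ℝ := fun t => (∑ j ∈ Finset.range m, φ j (c j t)) / m
  have hval : ∀ j < m, ∀ t ∈ Icc (s j) (s (j + 1)), g t * m = j + φ j t := by
    intro j hj t ht
    have hsum : ∑ i ∈ Finset.range m, φ i (c i t) =
        ∑ i ∈ Finset.range m, ((if i < j then (1 : ℝ) else 0) + if i = j then φ j t else 0) := by
      refine Finset.sum_congr rfl fun i hi => ?_
      have hi := Finset.mem_range.1 hi
      rcases lt_trichotomy i j with h | h | h
      · have : c i t = s (i + 1) := by
          simp only [c]
          rw [min_eq_right ((hs h).trans ht.1), max_eq_right (hs i.le_succ)]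
        rw [this, h1 i hi]
        simp [h, h.ne]
      · subst h
        simp [hceq i t ht]
      · have : c i t = s i := by
          simp only [c]
          rw [max_eq_left ((min_le_left _ _).trans (ht.2.trans (hs h)))]
        rw [this, h0 i hi]
        simp [h.not_gt, h.ne']
    have hcard : ∑ i ∈ Finset.range m, (if i < j then (1 : ℝ) else 0) = j := by
      rw [Finset.sum_ite, Finset.sum_const_zero, add_zero, Finset.sum_const, nsmul_one]
      have : Finset.filter (fun i => i < j) (Finset.range m) = Finset.range j := by
        ext i; simp; omega
      rw [this, Finset.card_range]
    simp only [g]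
    rw [div_mul_cancel₀ _ hm'.ne', hsum, Finset.sum_add_distrib, hcard]
    simp [hj]
  refine ⟨g, IsReparam.of_strictMonoOn ?_ ?_ ?_ ?_, hval⟩
  · refine (continuousOn_finsetSum _ fun j hj => ?_).div_const _
    refine (hc j (Finset.mem_range.1 hj)).comp ?_ fun t _ => hcm j t
    exact (continuous_const.max (continuous_id.min continuous_const)).continuousOn
  · intro t ht t' ht' h
    refine div_lt_div_of_pos_right (Finset.sum_lt_sum ?_ ?_) hm'
    · intro j hj
      exact (hφ j (Finset.mem_range.1 hj)).monotoneOn (hcm j t) (hcm j t') (hcmono j h.le)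
    · have hex : ∃ j, t < s (j + 1) := by
        refine ⟨m - 1, ?_⟩
        rw [Nat.sub_add_cancel hm, hsm]
        exact h.trans_le ht'.2
      classical
      let j := Nat.find hex
      have hj : t < s (j + 1) := Nat.find_spec hex
      have hjm : j < m := by
        have : j ≤ m - 1 := Nat.find_min' hex (by
          rw [Nat.sub_add_cancel hm, hsm]; exact h.trans_le ht'.2)
        omega
      have hj' : s j ≤ t := by
        rcases Nat.eq_zero_or_pos j with h' | h'
        · rw [h', hs0]; exact ht.1
        · have := Nat.find_min hex (m := j - 1) (Nat.sub_lt h' one_pos)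
          rw [Nat.sub_add_cancel (Nat.one_le_of_lt h')] at this
          exact not_lt.1 this
      refine ⟨j, Finset.mem_range.2 hjm, hφ j hjm (hcm j t) (hcm j t') ?_⟩
      rw [hceq j t ⟨hj', hj.le⟩]
      exact lt_max_of_lt_right (lt_min h hj)
  · have := hval 0 hm (s 0) ⟨le_rfl, hs (Nat.zero_le _)⟩
    rw [h0 0 hm, hs0] at this
    simpa [hm'.ne'] using this
  · have hm1 : m - 1 < m := Nat.sub_lt hm one_pos
    have := hval (m - 1) hm1 (s (m - 1 + 1)) ⟨hs (Nat.le_succ _), le_rfl⟩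
    rw [h1 _ hm1, Nat.sub_add_cancel hm, hsm, Nat.cast_sub hm, Nat.cast_one,
      sub_add_cancel] at this
    exact (mul_eq_right₀ hm'.ne').1 this

lemma polyCurve_eq {n : ℕ} (v : Fin (n+1) → EuclideanSpace ℝ (Fin d)) {i : ℕ} {t : ℝ}
    (h₁ : (i : ℝ) ≤ t * n) (h₂ : t * n ≤ i + 1) :
    polyCurve v t = (1 - (t * n - i)) • vtx v i + (t * n - i) • vtx v (i + 1) := by
  rcases h₂.lt_or_eq with h | h
  · have : ⌊t * n⌋₊ = i := (Nat.floor_eq_iff ((Nat.cast_nonneg i).trans h₁)).2 ⟨h₁, h⟩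
    simp only [polyCurve, this]
  · have : ⌊t * n⌋₊ = i + 1 := by rw [h]; exact_mod_cast Nat.floor_natCast (i + 1)
    simp only [polyCurve, this]
    simp [h]

lemma polyCurve_natCast_div {n : ℕ} (hn : 0 < n) (v : Fin (n+1) → EuclideanSpace ℝ (Fin d))
    (i : ℕ) : polyCurve v ((i : ℝ) / n) = vtx v i := by
  have h : (i : ℝ) / n * n = i := div_mul_cancel₀ _ (by exact_mod_cast hn.ne')
  rw [polyCurve_eq v (i := i) h.ge (by linarith), h]
  simp

lemma polyCurve_lineMap {n : ℕ} (v : Fin (n+1) → EuclideanSpace ℝ (Fin d)) {i : ℕ} {a b c : ℝ}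
    (ha : (i : ℝ) ≤ a * n ∧ a * n ≤ i + 1) (hb : (i : ℝ) ≤ b * n ∧ b * n ≤ i + 1)
    (hc : c ∈ Icc (0 : ℝ) 1) :
    polyCurve v ((1 - c) * a + c * b) = (1 - c) • polyCurve v a + c • polyCurve v b := by
  have hc' : 0 ≤ 1 - c := by linarith [hc.2]
  rw [polyCurve_eq v ha.1 ha.2, polyCurve_eq v hb.1 hb.2, polyCurve_eq v (i := i)
    (by nlinarith [mul_le_mul_of_nonneg_left ha.1 hc', mul_le_mul_of_nonneg_left hb.1 hc.1])
    (by nlinarith [mul_le_mul_of_nonneg_left ha.2 hc', mul_le_mul_of_nonneg_left hb.2 hc.1])]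
  module

lemma exists_norm_polyCurve_le {n : ℕ} (v : Fin (n+1) → EuclideanSpace ℝ (Fin d)) :
    ∃ C, ∀ t, 0 ≤ t → ‖polyCurve v t‖ ≤ C := by
  refine ⟨∑ i, ‖v i‖, fun t ht => ?_⟩
  have hv : ∀ i, ‖vtx v i‖ ≤ ∑ i, ‖v i‖ := fun i =>
    Finset.single_le_sum (f := fun i => ‖v i‖) (fun _ _ => norm_nonneg _) (Finset.mem_univ _)
  have h₁ : (⌊t * n⌋₊ : ℝ) ≤ t * n := Nat.floor_le (by positivity)
  have h₂ := Nat.lt_floor_add_one (t * n)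
  refine (norm_add_le _ _).trans ?_
  rw [norm_smul, norm_smul, Real.norm_of_nonneg (by linarith), Real.norm_of_nonneg (by linarith)]
  nlinarith [mul_le_mul_of_nonneg_left (hv ⌊t * n⌋₊)
      (show 0 ≤ 1 - (t * n - ⌊t * n⌋₊) by linarith),
    mul_le_mul_of_nonneg_left (hv (⌊t * n⌋₊ + 1)) (show 0 ≤ t * n - ⌊t * n⌋₊ by linarith)]

lemma norm_sub_le_frechetWidth {n l : ℕ} (z : Fin (n+1) → EuclideanSpace ℝ (Fin d))
    (y : Fin (l+1) → EuclideanSpace ℝ (Fin d)) {f : ℝ → ℝ} (hf : IsReparam f) {t : ℝ}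
    (ht : t ∈ Icc (0 : ℝ) 1) :
    ‖polyCurve y (f t) - polyCurve z t‖ ≤ frechetWidth (polyCurve y) (polyCurve z) f := by
  obtain ⟨C, hC⟩ := exists_norm_polyCurve_le y
  obtain ⟨D, hD⟩ := exists_norm_polyCurve_le z
  refine le_ciSup (f := fun t : Icc (0 : ℝ) 1 => ‖polyCurve y (f t) - polyCurve z t‖)
    ⟨C + D, ?_⟩ ⟨t, ht⟩
  rintro _ ⟨u, rfl⟩
  exact (norm_sub_le _ _).trans (add_le_add (hC _ (hf.mapsTo u.2).1) (hD _ u.2.1))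

/-- A curve within distance `w` of a line segment is within distance `2 * w` of its chord. -/
lemma exists_chord_param {l : ℕ} (y : Fin (l+1) → EuclideanSpace ℝ (Fin d))
    (Z : ℝ → EuclideanSpace ℝ (Fin d)) {i : ℕ} {a b w : ℝ} (hab : a < b) {h : ℝ → ℝ}
    (hc : ContinuousOn h (Icc a b)) (hm : StrictMonoOn h (Icc a b))
    (hi : (i : ℝ) ≤ h a * l ∧ h b * l ≤ i + 1)
    (hw : ∀ t ∈ Icc a b, ‖polyCurve y (h t) - Z t‖ ≤ w) :
    ∃ φ : ℝ → ℝ, ContinuousOn φ (Icc a b) ∧ StrictMonoOn φ (Icc a b) ∧ φ a = 0 ∧ φ b = 1 ∧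
      ∀ t ∈ Icc a b, ‖(1 - φ t) • Z a + φ t • Z b - Z t‖ ≤ 2 * w := by
  have ha : a ∈ Icc a b := ⟨le_rfl, hab.le⟩
  have hb : b ∈ Icc a b := ⟨hab.le, le_rfl⟩
  have hpos : 0 < h b - h a := sub_pos.2 (hm ha hb hab)
  have hl : h a * l ≤ h b * l := mul_le_mul_of_nonneg_right (by linarith) (Nat.cast_nonneg l)
  refine ⟨fun t => (h t - h a) / (h b - h a), (hc.sub continuousOn_const).div_const _, ?_, by simp,
    div_self hpos.ne', ?_⟩
  · intro t ht t' ht' htt'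
    exact div_lt_div_of_pos_right (by linarith [hm ht ht' htt']) hpos
  intro t ht
  set c := (h t - h a) / (h b - h a) with hcdef
  have hat : h a ≤ h t := hm.monotoneOn ha ht ht.1
  have htb : h t ≤ h b := hm.monotoneOn ht hb ht.2
  have hc01 : c ∈ Icc (0 : ℝ) 1 :=
    ⟨div_nonneg (by linarith) hpos.le, (div_le_one hpos).2 (by linarith)⟩
  have hht : h t = (1 - c) * h a + c * h b := by
    have : c * (h b - h a) = h t - h a := div_mul_cancel₀ _ hpos.ne'
    linarith
  have hy := polyCurve_lineMap y (i := i) (a := h a) (b := h b)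
    ⟨hi.1, hl.trans hi.2⟩ ⟨hi.1.trans hl, hi.2⟩ hc01
  rw [← hht] at hy
  have key : (1 - c) • Z a + c • Z b - Z t = (polyCurve y (h t) - Z t) -
      ((1 - c) • (polyCurve y (h a) - Z a) + c • (polyCurve y (h b) - Z b)) := by
    rw [hy]; module
  rw [key]
  have h1c : 0 ≤ 1 - c := by linarith [hc01.2]
  refine (norm_sub_le _ _).trans ?_
  have h2 := norm_add_le ((1 - c) • (polyCurve y (h a) - Z a)) (c • (polyCurve y (h b) - Z b))
  rw [norm_smul, norm_smul, Real.norm_of_nonneg h1c, Real.norm_of_nonneg hc01.1] at h2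
  linarith [hw t ht, mul_le_mul_of_nonneg_left (hw a ha) h1c,
    mul_le_mul_of_nonneg_left (hw b hb) hc01.1]

/-- A spine curve is close to `Z` if each of its edges either is an edge of `Z` or replaces a
part of `Z` that is matched to a single edge of the nearby curve `y`. -/
lemma frechetDist_spine_le {n l m : ℕ} (hn : 0 < n) (hm : 0 < m)
    (z : Fin (n+1) → EuclideanSpace ℝ (Fin d)) (y : Fin (l+1) → EuclideanSpace ℝ (Fin d))
    {idx : Fin (m+1) → Fin (n+1)} (hidx : StrictMono idx) (h0 : idx 0 = 0)
    (hlast : idx (Fin.last m) = Fin.last n) {f : ℝ → ℝ} (hf : IsReparam f) {w : ℝ}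
    (hw : ∀ t ∈ Icc (0 : ℝ) 1, ‖polyCurve y (f t) - polyCurve z t‖ ≤ w)
    (hedge : ∀ j : Fin m, (idx j.succ : ℕ) = idx j.castSucc + 1 ∨
      ∃ i : ℕ, (i : ℝ) ≤ f ((idx j.castSucc : ℕ) / n) * l ∧
        f ((idx j.succ : ℕ) / n) * l ≤ i + 1) :
    frechetDist (polyCurve (z ∘ idx)) (polyCurve z) ≤ 2 * w := by
  have hn' : (0 : ℝ) < n := by exact_mod_cast hn
  have hw0 : 0 ≤ w := (norm_nonneg _).trans (hw 0 (by simp))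
  let e : ℕ → Fin (m+1) := fun j => ⟨min j m, Nat.lt_succ_of_le (min_le_right j m)⟩
  let s : ℕ → ℝ := fun j => ((idx (e j) : ℕ) : ℝ) / n
  have hs : Monotone s := fun i j hij => by
    refine div_le_div_of_nonneg_right ?_ hn'.le
    exact_mod_cast hidx.monotone (show e i ≤ e j from min_le_min hij le_rfl)
  have hlt : ∀ j < m, s j < s (j + 1) := fun j hj => by
    refine div_lt_div_of_pos_right ?_ hn'
    exact_mod_cast hidx (show e j < e (j + 1) by
      rw [Fin.lt_def]; simp only [e]; omega)
  have hs0 : s 0 = 0 := by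
    have : e 0 = 0 := by ext; simp [e]
    simp [s, this, h0]
  have hsm : s m = 1 := by
    have : e m = Fin.last m := by ext; simp [e]
    simp [s, this, hlast, hn'.ne']
  have hsub : ∀ j, Icc (s j) (s (j + 1)) ⊆ Icc 0 1 := fun j => by
    refine Icc_subset_Icc (div_nonneg (Nat.cast_nonneg _) hn'.le) ((div_le_one hn').2 ?_)
    exact_mod_cast Nat.lt_succ_iff.1 (idx (e (j + 1))).2
  have hex : ∀ j, ∃ φ : ℝ → ℝ, j < m → ContinuousOn φ (Icc (s j) (s (j + 1))) ∧
      StrictMonoOn φ (Icc (s j) (s (j + 1))) ∧ φ (s j) = 0 ∧ φ (s (j + 1)) = 1 ∧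
      ∀ t ∈ Icc (s j) (s (j + 1)), ‖(1 - φ t) • polyCurve z (s j) +
        φ t • polyCurve z (s (j + 1)) - polyCurve z t‖ ≤ 2 * w := by
    intro j
    by_cases hj : j < m
    swap
    · exact ⟨id, fun h => (hj h).elim⟩
    have e1 : (⟨j, hj⟩ : Fin m).castSucc = e j := by ext; simp [e, hj.le]
    have e2 : (⟨j, hj⟩ : Fin m).succ = e (j + 1) := by ext; simp [e]; omega
    have h := hedge ⟨j, hj⟩
    rw [e1, e2] at h
    rcases h with h | ⟨i, hi⟩
    · obtain ⟨φ, hφ⟩ := exists_chord_param z (polyCurve z) (i := idx (e j)) (w := w) (hlt j hj)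
        (h := id) continuousOn_id (strictMono_id.strictMonoOn _)
        (by simp [s, hn'.ne', h]) (by simp [hw0])
      exact ⟨φ, fun _ => hφ⟩
    · obtain ⟨φ, hφ⟩ := exists_chord_param y (polyCurve z) (i := i) (w := w) (hlt j hj)
        (hf.contOn.mono (hsub j)) (hf.strictMonoOn.mono (hsub j)) hi
        (fun t ht => hw t (hsub j ht))
      exact ⟨φ, fun _ => hφ⟩
  choose φ hφ using hex
  obtain ⟨g, hg, hgval⟩ := exists_isReparam_glue hm hs hs0 hsm
    (fun j hj => (hφ j hj).1) (fun j hj => (hφ j hj).2.1) (fun j hj => (hφ j hj).2.2.1)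
    (fun j hj => (hφ j hj).2.2.2.1)
  refine frechetDist_le hg fun t ht => ?_
  obtain ⟨j, hj, htj⟩ : ∃ j < m, t ∈ Icc (s j) (s (j + 1)) := by
    classical
    have hex : ∃ j, t ≤ s (j + 1) := ⟨m - 1, by rw [Nat.sub_add_cancel hm, hsm]; exact ht.2⟩
    refine ⟨Nat.find hex, ?_, ?_, Nat.find_spec hex⟩
    · have := Nat.find_min' hex (m := m - 1) (by rw [Nat.sub_add_cancel hm, hsm]; exact ht.2)
      omega
    · rcases Nat.eq_zero_or_pos (Nat.find hex) with h' | h'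
      · rw [h', hs0]; exact ht.1
      · have := Nat.find_min hex (m := Nat.find hex - 1) (Nat.sub_lt h' one_pos)
        rw [Nat.sub_add_cancel (Nat.one_le_of_lt h')] at this
        exact (not_le.1 this).le
  obtain ⟨-, hmono, hφ0, hφ1, hbound⟩ := hφ j hj
  have hgt := hgval j hj t htj
  have hv : ∀ j, vtx (z ∘ idx) j = polyCurve z (s j) := fun j => by
    rw [polyCurve_natCast_div hn]
    simp only [vtx, Function.comp, e]
    congr 1
    ext
    simp [Nat.lt_succ_iff.1 (idx _).2]
  have hle0 : 0 ≤ φ j t := hφ0 ▸ hmono.monotoneOn ⟨le_rfl, (hlt j hj).le⟩ htj htj.1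
  have hle1 : φ j t ≤ 1 := hφ1 ▸ hmono.monotoneOn htj ⟨(hlt j hj).le, le_rfl⟩ htj.2
  rw [polyCurve_eq (z ∘ idx) (i := j) (by linarith) (by linarith), hv, hv, hgt,
    add_sub_cancel_left]
  exact hbound t htj

/-- The spine through the edges of `Z` that carry the points matched to the interior vertices
of the nearby curve `y`. -/
lemma exists_spine_of_reparam {n l k : ℕ} (hn : 0 < n) (hk : 2 ≤ k) (hl : l + 1 ≤ k)
    (z : Fin (n+1) → EuclideanSpace ℝ (Fin d)) (y : Fin (l+1) → EuclideanSpace ℝ (Fin d))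
    {f : ℝ → ℝ} (hf : IsReparam f) {w : ℝ}
    (hw : ∀ t ∈ Icc (0 : ℝ) 1, ‖polyCurve y (f t) - polyCurve z t‖ ≤ w) :
    ∃ (m : ℕ) (idx : Fin (m+1) → Fin (n+1)),
      m + 1 ≤ 2 * (k - 1) + 1 ∧ StrictMono idx ∧
      idx 0 = 0 ∧ idx (Fin.last m) = Fin.last n ∧
      frechetDist (polyCurve (z ∘ idx)) (polyCurve z) ≤ 2 * w := by
  classical
  have hn' : (0 : ℝ) < n := by exact_mod_cast hn
  have hinv : ∀ i : ℕ, ∃ t : ℝ, 0 < i → i < l → t ∈ Icc (0 : ℝ) 1 ∧ f t = i / l := by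
    intro i
    by_cases h : 0 < i ∧ i < l
    · have hl' : (0 : ℝ) < l := by exact_mod_cast h.1.trans h.2
      obtain ⟨t, ht, hft⟩ := hf.surjOn (show (i : ℝ) / l ∈ Icc (0 : ℝ) 1 from
        ⟨by positivity, (div_le_one hl').2 (by exact_mod_cast h.2.le)⟩)
      exact ⟨t, fun _ _ => ⟨ht, hft⟩⟩
    · exact ⟨0, fun h1 h2 => (h ⟨h1, h2⟩).elim⟩
  choose τ hτ using hinv
  let V : Finset (Fin (n+1)) := {0, Fin.last n} ∪
    (Finset.Ioo 0 l).biUnion fun i =>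
      {Fin.ofNat (n+1) ⌊τ i * n⌋₊, Fin.ofNat (n+1) (⌊τ i * n⌋₊ + 1)}
  have h0V : 0 ∈ V := by simp [V]
  have hnV : Fin.last n ∈ V := by simp [V]
  have hcard : V.card ≤ 2 * (k - 1) + 1 := by
    refine (Finset.card_union_le _ _).trans ?_
    have h1 : ({0, Fin.last n} : Finset (Fin (n+1))).card ≤ 2 := Finset.card_le_two
    have h2 := Finset.card_biUnion_le_card_mul (Finset.Ioo 0 l) (fun i =>
      ({Fin.ofNat (n+1) ⌊τ i * n⌋₊, Fin.ofNat (n+1) (⌊τ i * n⌋₊ + 1)} : Finset (Fin (n+1)))) 2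
      fun i _ => Finset.card_le_two
    rw [Nat.card_Ioo] at h2
    omega
  have h2card : 1 < V.card := Finset.one_lt_card.2 ⟨0, h0V, Fin.last n, hnV, fun h =>
    hn.ne (by simpa using congrArg Fin.val h)⟩
  obtain ⟨m, hm⟩ : ∃ m, V.card = m + 1 := ⟨V.card - 1, by omega⟩
  let idx : Fin (m+1) → Fin (n+1) := V.orderEmbOfFin hm
  have hidx : StrictMono idx := (V.orderEmbOfFin hm).strictMono
  have hrange : ∀ x ∈ V, ∃ j, idx j = x := fun x hx => by
    have : x ∈ Set.range (V.orderEmbOfFin hm) := by rw [Finset.range_orderEmbOfFin]; exact hx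
    exact this
  have hidx0 : idx 0 = 0 := by
    obtain ⟨j, hj⟩ := hrange 0 h0V
    exact le_antisymm (hj ▸ hidx.monotone (Fin.zero_le j)) (Fin.zero_le _)
  have hidxm : idx (Fin.last m) = Fin.last n := by
    obtain ⟨j, hj⟩ := hrange _ hnV
    exact le_antisymm (Fin.le_last _) (hj ▸ hidx.monotone (Fin.le_last j))
  have hgap : ∀ (j : Fin m), ∀ x ∈ V, idx j.castSucc < x → idx j.succ ≤ x := by
    intro j x hx h
    obtain ⟨i, rfl⟩ := hrange x hx
    exact hidx.monotone (Fin.castSucc_lt_iff_succ_le.1 (hidx.lt_iff_lt.1 h))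
  refine ⟨m, idx, hm ▸ hcard, hidx, hidx0, hidxm,
    frechetDist_spine_le hn (by omega) z y hidx hidx0 hidxm hf hw fun j => ?_⟩
  have hlt : (idx j.castSucc : ℕ) < idx j.succ := hidx Fin.castSucc_lt_succ
  have hle : (idx j.succ : ℕ) ≤ n := Nat.lt_succ_iff.1 (idx j.succ).2
  set a : ℕ := (idx j.castSucc : ℕ) with ha
  set b : ℕ := (idx j.succ : ℕ) with hb
  have hpar : ∀ c : ℕ, c ≤ n → (c : ℝ) / n ∈ Icc (0 : ℝ) 1 := fun c hc =>
    ⟨by positivity, (div_le_one hn').2 (by exact_mod_cast hc)⟩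
  have haI := hpar a (by omega)
  have hbI := hpar b hle
  by_contra! hcon
  obtain ⟨hne, hcon⟩ := hcon
  have hfa := hf.mapsTo haI
  have hfb := hf.mapsTo hbI
  set i := ⌊f (a / n) * l⌋₊ with hidef
  have hi := hcon i (Nat.floor_le (mul_nonneg hfa.1 (Nat.cast_nonneg l)))
  have hi' : f (a / n) * l < i + 1 := Nat.lt_floor_add_one _
  have hil : i + 1 < l := by
    have : (i : ℝ) + 1 < l := hi.trans_le (mul_le_of_le_one_left (Nat.cast_nonneg l) hfb.2)
    exact_mod_cast this
  have hl' : (0 : ℝ) < l := by exact_mod_cast (Nat.zero_le _).trans_lt hil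
  obtain ⟨hτI, hτf⟩ := hτ (i + 1) i.succ_pos hil
  push_cast at hτf
  set t := τ (i + 1) with ht
  have hat : (a : ℝ) < t * n := by
    rw [← div_lt_iff₀ hn']
    refine (hf.strictMonoOn.lt_iff_lt haI hτI).1 ?_
    rw [hτf, lt_div_iff₀ hl']
    exact hi'
  have htb : t * n < b := by
    rw [← lt_div_iff₀ hn']
    refine (hf.strictMonoOn.lt_iff_lt hτI hbI).1 ?_
    rw [hτf, div_lt_iff₀ hl']
    exact hi
  have hfl1 : a ≤ ⌊t * n⌋₊ := Nat.le_floor hat.le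
  have hfl2 : ⌊t * n⌋₊ < b := (Nat.floor_lt ((Nat.cast_nonneg a).trans hat.le)).2 htb
  have hmem1 : Fin.ofNat (n+1) ⌊t * n⌋₊ ∈ V := Finset.mem_union_right _
    (Finset.mem_biUnion.2 ⟨i + 1, Finset.mem_Ioo.2 ⟨i.succ_pos, hil⟩, by simp [ht]⟩)
  have hmem2 : Fin.ofNat (n+1) (⌊t * n⌋₊ + 1) ∈ V := Finset.mem_union_right _
    (Finset.mem_biUnion.2 ⟨i + 1, Finset.mem_Ioo.2 ⟨i.succ_pos, hil⟩, by simp [ht]⟩)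
  have hv1 : (Fin.ofNat (n+1) ⌊t * n⌋₊ : ℕ) = ⌊t * n⌋₊ := Nat.mod_eq_of_lt (by omega)
  have hv2 : (Fin.ofNat (n+1) (⌊t * n⌋₊ + 1) : ℕ) = ⌊t * n⌋₊ + 1 :=
    Nat.mod_eq_of_lt (by omega)
  have g1 := hgap j _ hmem1
  have g2 := hgap j _ hmem2
  rw [Fin.lt_def, Fin.le_def, hv1] at g1
  rw [Fin.lt_def, Fin.le_def, hv2] at g2
  omega

/-- For any polygonal curve `Z` with vertices `z 0, …, z n` and any
`k ≥ 2` there is a subset `V` of the vertices (given by a strictly increasing index map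
`idx`) containing both endpoints, of size at most `2(k−1)+1`, such that the spine curve of
`Z` through `V` is within Fréchet distance `11·d_F(Y, Z)` of `Z` for every polygonal
curve `Y` with at most `k` vertices. -/
theorem exists_good_spine_curve {d n : ℕ} (z : Fin (n+1) → EuclideanSpace ℝ (Fin d))
    (k : ℕ) (hk : 2 ≤ k) :
    ∃ (m : ℕ) (idx : Fin (m+1) → Fin (n+1)),
      m + 1 ≤ 2 * (k - 1) + 1 ∧ StrictMono idx ∧
      idx 0 = 0 ∧ idx (Fin.last m) = Fin.last n ∧
      ∀ (l : ℕ) (y : Fin (l+1) → EuclideanSpace ℝ (Fin d)), l + 1 ≤ k →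
        frechetDist (polyCurve (z ∘ idx)) (polyCurve z) ≤
          11 * frechetDist (polyCurve y) (polyCurve z) := by
  rcases Nat.eq_zero_or_pos n with rfl | hn
  · refine ⟨0, id, by omega, strictMono_id, rfl, rfl, fun l y _ => ?_⟩
    refine (frechetDist_le (w := 0) isReparam_id fun t _ => by simp).trans ?_
    exact mul_nonneg (by norm_num) (frechetDist_nonneg _ _)
  let S : Set (Σ m : Fin (2 * (k - 1) + 1), (Fin (m + 1) → Fin (n+1))) :=
    {p | StrictMono p.2 ∧ p.2 0 = 0 ∧ p.2 (Fin.last p.1) = Fin.last n}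
  have hspine : ∀ (l : ℕ) (y : Fin (l+1) → EuclideanSpace ℝ (Fin d)), l + 1 ≤ k →
      ∀ f, IsReparam f → ∃ p ∈ S, frechetDist (polyCurve (z ∘ p.2)) (polyCurve z) ≤
        2 * frechetWidth (polyCurve y) (polyCurve z) f := by
    intro l y hl f hf
    obtain ⟨m, idx, hm, h1, h2, h3, h4⟩ := exists_spine_of_reparam hn hk hl z y hf
      fun t ht => norm_sub_le_frechetWidth z y hf ht
    exact ⟨⟨⟨m, hm⟩, idx⟩, ⟨h1, h2, h3⟩, h4⟩
  have hne : S.Nonempty := by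
    obtain ⟨p, hp, -⟩ := hspine 0 (fun _ => 0) (by omega) id isReparam_id
    exact ⟨p, hp⟩
  obtain ⟨⟨m, idx⟩, ⟨h1, h2, h3⟩, hmin⟩ := Set.exists_min_image S
    (fun p => frechetDist (polyCurve (z ∘ p.2)) (polyCurve z)) S.toFinite hne
  refine ⟨m, idx, m.2, h1, h2, h3, fun l y hl => ?_⟩
  rw [← div_le_iff₀' (by norm_num)]
  refine le_csInf ⟨_, id, isReparam_id, rfl⟩ ?_
  rintro w ⟨f, hf, rfl⟩
  obtain ⟨p, hp, hpw⟩ := hspine l y hl f hf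
  have := (hmin p hp).trans hpw
  dsimp only at this
  rw [div_le_iff₀' (by norm_num)]
  linarith [frechetWidth_nonneg (polyCurve y) (polyCurve z) f]

end Jaywalk
end
end
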